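/- Let ε, μ : ℝ³ → ℝ be C² up to the boundary of Π with ε > 0 and μ > 0 on the closure of Π, and let λ ∈ ℝ. Let u, v : ℝ³ → ℂ³ be C² up to the boundary with compact axial support, satisfying on Π: curl u = iλ·μ·v, curl v = −iλ·ε·u, div(εu) = 0 and div(μv) = 0, and on ∂Π: u = ⟨u, ν⟩·ν (tangential component of u vanishes) and ⟨v, ν⟩ = 0. Let w, f : ℝ³ → ℂ³ be C² up to the boundary with w = ⟨w, ν⟩·ν and ⟨f, ν⟩ = 0 on ∂Π. Define the ℂ⁶-valued functions Φ = (ε^{1/2}u, μ^{1/2}v) and Ψ = (ε^{−1/2}μ⁻¹w, ε⁻¹μ^{−1/2}f). Then ∫_Π (Σⱼ ⟨∂ⱼΦ, ∂ⱼΨ⟩_{ℂ⁶} + ⟨VΦ, Ψ⟩_{ℂ⁶}) dx + ∫_{∂Π} ⟨ΣΦ, Ψ⟩_{ℂ⁶} dS = 0, where the 6×6 matrix fields V and Σ are given in 3×3 blocks by V = [[W(ε) − εμλ²·I₃, −2iλ·F], [2iλ·F, W(μ) − εμλ²·I₃]], with F the antisymmetric matrix acting on z ∈ ℂ³ by F·z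 = [∇((εμ)^{1/2}), z], and Σ = [[(R⁻¹ + (2ε)⁻¹·∂_νε)·I₃, 0], [0, R⁻¹·P − (2μ)⁻¹·(∂_νμ)·I₃]], with P = diag(1, 1, 0), I₃ the 3×3 identity matrix, and ∂_νg = ⟨∇g, ν⟩ the normal derivative. -/

import Mathlib

noncomputable section

open MeasureTheory Real Complex

/-- Points of `ℝ³`. -/
abbrev V3 := Fin 3 → ℝ
/-- Vectors of `ℂ³`. -/
abbrev C3 := Fin 3 → ℂ

/-- Partial derivative `∂ⱼ` of a complex scalar function on `ℝ³`. -/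
def pd (j : Fin 3) (f : V3 → ℂ) (x : V3) : ℂ := fderiv ℝ f x (Pi.single j 1)

/-- Partial derivative `∂ⱼ` of a real scalar function on `ℝ³`. -/
def pdR (j : Fin 3) (f : V3 → ℝ) (x : V3) : ℝ := fderiv ℝ f x (Pi.single j 1)

/-- Partial derivative `∂ⱼ` of a vector field, taken componentwise. -/
def pdV (j : Fin 3) (a : V3 → C3) (x : V3) : C3 := fun i => pd j (fun y => a y i) x

/-- curl a = (∂₂a₃ − ∂₃a₂, ∂₃a₁ − ∂₁a₃, ∂₁a₂ − ∂₂a₁)  (indices 0,1,2). -/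
def vcurl (a : V3 → C3) (x : V3) : C3 :=
  ![pd 1 (fun y => a y 2) x - pd 2 (fun y => a y 1) x,
    pd 2 (fun y => a y 0) x - pd 0 (fun y => a y 2) x,
    pd 0 (fun y => a y 1) x - pd 1 (fun y => a y 0) x]

/-- div a = ∂₁a₁ + ∂₂a₂ + ∂₃a₃. -/
def vdiv (a : V3 → C3) (x : V3) : ℂ := ∑ j, pd j (fun y => a y j) x

/-- The bilinear (unconjugated) cross product on ℂ³. -/
def cross (a b : C3) : C3 :=
  ![a 1 * b 2 - a 2 * b 1, a 2 * b 0 - a 0 * b 2, a 0 * b 1 - a 1 * b 0]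

/-- The Hermitian inner product ⟨a, b⟩ = Σⱼ aⱼ · conj(bⱼ). -/
def hinner (a b : C3) : ℂ := ∑ j, a j * (starRingEnd ℂ) (b j)

/-- The gradient of a real function, viewed as a complex vector. -/
def gradC (g : V3 → ℝ) (x : V3) : C3 := fun j => (pdR j g x : ℂ)

/-- The Laplacian Δg = ∂₁²g + ∂₂²g + ∂₃²g of a real function. -/
def lapR (g : V3 → ℝ) (x : V3) : ℝ := ∑ j, pdR j (fun y => pdR j g y) x

/-- The solid infinite circular cylinder Π of radius `R`. -/
def Cyl (R : ℝ) : Set V3 := {x | x 0 ^ 2 + x 1 ^ 2 < R ^ 2}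

/-- The boundary ∂Π of the cylinder. -/
def bCyl (R : ℝ) : Set V3 := {x | x 0 ^ 2 + x 1 ^ 2 = R ^ 2}

/-- The outward unit normal of the cylinder at a boundary point. -/
def nuR (R : ℝ) (x : V3) : V3 := ![x 0 / R, x 1 / R, 0]

/-- The outward unit normal, viewed as a complex vector. -/
def nuC (R : ℝ) (x : V3) : C3 := fun j => (nuR R x j : ℂ)

/-- The normal component ⟨z, ν⟩ of z ∈ ℂ³ at a boundary point of the cylinder. -/
def ncomp (R : ℝ) (x : V3) (z : C3) : ℂ := ∑ k, z k * (nuR R x k : ℂ)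

/-- The normal derivative ∂_ν g = ⟨∇g, ν⟩ of a real function at a boundary point. -/
def dnu (R : ℝ) (g : V3 → ℝ) (x : V3) : ℝ := ∑ k, pdR k g x * nuR R x k

/-- The surface integral ∫_{∂Π} F dS = ∫_ℝ ∫₀^{2π} F(R cos θ, R sin θ, t)·R dθ dt. -/
def surfInt (R : ℝ) (F : V3 → ℂ) : ℂ :=
  ∫ t : ℝ, ∫ θ in (0:ℝ)..(2 * π), F ![R * Real.cos θ, R * Real.sin θ, t] * (R : ℂ)

/-- `f` is `C^k` up to the boundary of the open set `S`: it is `k` times continuously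
differentiable on an open neighborhood of the closure of `S`. -/
def UpTo {E : Type*} [NormedAddCommGroup E] [NormedSpace ℝ E]
    (k : ℕ) (S : Set V3) (f : V3 → E) : Prop :=
  ∃ U : Set V3, IsOpen U ∧ closure S ⊆ U ∧ ContDiffOn ℝ k f U

/-- `f` has compact axial support: it vanishes whenever `|x₃| ≥ T` for some `T > 0`. -/
def AxialSupp {E : Type*} [Zero E] (f : V3 → E) : Prop :=
  ∃ T > 0, ∀ x : V3, T ≤ |x 2| → f x = 0

/-- The matrix W₀(μ)ⱼₖ = μ⁻¹(Δμ)δⱼₖ + μ⁻²(∂ⱼμ)(∂ₖμ) − μ⁻¹∂ⱼ∂ₖμ. -/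
def W0 (μ : V3 → ℝ) (x : V3) (j k : Fin 3) : ℝ :=
  (μ x)⁻¹ * lapR μ x * (if j = k then 1 else 0)
    + ((μ x) ^ 2)⁻¹ * pdR j μ x * pdR k μ x
    - (μ x)⁻¹ * pdR j (fun y => pdR k μ y) x

/-- The matrix W(μ)ⱼₖ = ((2μ)⁻¹Δμ − (4μ²)⁻¹|∇μ|²)δⱼₖ + μ⁻²(∂ⱼμ)(∂ₖμ) − μ⁻¹∂ⱼ∂ₖμ. -/
def Wm (μ : V3 → ℝ) (x : V3) (j k : Fin 3) : ℝ :=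
  ((2 * μ x)⁻¹ * lapR μ x - (4 * (μ x) ^ 2)⁻¹ * (∑ i, (pdR i μ x) ^ 2))
      * (if j = k then 1 else 0)
    + ((μ x) ^ 2)⁻¹ * pdR j μ x * pdR k μ x
    - (μ x)⁻¹ * pdR j (fun y => pdR k μ y) x


/-- First three components of Φ = (ε^{1/2}u, μ^{1/2}v). -/
def Phi1 (ε : V3 → ℝ) (u : V3 → C3) : V3 → C3 := fun y => (Real.sqrt (ε y) : ℂ) • u y

/-- Last three components of Φ = (ε^{1/2}u, μ^{1/2}v). -/
def Phi2 (μ : V3 → ℝ) (v : V3 → C3) : V3 → C3 := fun y => (Real.sqrt (μ y) : ℂ) • v y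

/-- First three components of Ψ = (ε^{−1/2}μ⁻¹w, ε⁻¹μ^{−1/2}f). -/
def Psi1 (ε μ : V3 → ℝ) (w : V3 → C3) : V3 → C3 :=
  fun y => (((Real.sqrt (ε y))⁻¹ * (μ y)⁻¹ : ℝ) : ℂ) • w y

/-- Last three components of Ψ = (ε^{−1/2}μ⁻¹w, ε⁻¹μ^{−1/2}f). -/
def Psi2 (ε μ : V3 → ℝ) (f : V3 → C3) : V3 → C3 :=
  fun y => (((ε y)⁻¹ * (Real.sqrt (μ y))⁻¹ : ℝ) : ℂ) • f y

/-- First three components of VΦ, where, in 3×3 blocks,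
V = [[W(ε) − εμλ²·I₃, −2iλ·F], [2iλ·F, W(μ) − εμλ²·I₃]] and F·z = [∇((εμ)^{1/2}), z]. -/
def VPhi1 (ε μ : V3 → ℝ) (lam : ℝ) (u v : V3 → C3) (x : V3) : C3 := fun j =>
  (∑ k, (Wm ε x j k : ℂ) * Phi1 ε u x k)
    - ((ε x * μ x * lam ^ 2 : ℝ) : ℂ) * Phi1 ε u x j
    - 2 * Complex.I * (lam : ℂ)
        * cross (gradC (fun y => Real.sqrt (ε y * μ y)) x) (Phi2 μ v x) j

/-- Last three components of VΦ. -/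
def VPhi2 (ε μ : V3 → ℝ) (lam : ℝ) (u v : V3 → C3) (x : V3) : C3 := fun j =>
  2 * Complex.I * (lam : ℂ)
      * cross (gradC (fun y => Real.sqrt (ε y * μ y)) x) (Phi1 ε u x) j
    + (∑ k, (Wm μ x j k : ℂ) * Phi2 μ v x k)
    - ((ε x * μ x * lam ^ 2 : ℝ) : ℂ) * Phi2 μ v x j

/-- First three components of ΣΦ, where, in 3×3 blocks,
Σ = [[(R⁻¹ + (2ε)⁻¹∂_νε)·I₃, 0], [0, R⁻¹·P − (2μ)⁻¹(∂_νμ)·I₃]] with P = diag(1,1,0). -/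
def SPhi1 (R : ℝ) (ε : V3 → ℝ) (u : V3 → C3) (x : V3) : C3 := fun j =>
  ((R⁻¹ + (2 * ε x)⁻¹ * dnu R ε x : ℝ) : ℂ) * Phi1 ε u x j

/-- Last three components of ΣΦ. -/
def SPhi2 (R : ℝ) (μ : V3 → ℝ) (v : V3 → C3) (x : V3) : C3 := fun j =>
  ((R⁻¹ * (if j = 2 then 0 else 1) - (2 * μ x)⁻¹ * dnu R μ x : ℝ) : ℂ) * Phi2 μ v x j

section PartialDerivatives

open Filter Topology

lemma pd_mul {f g : V3 → ℂ} {x : V3} (j : Fin 3) (hf : DifferentiableAt ℝ f x)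
    (hg : DifferentiableAt ℝ g x) :
    pd j (fun y => f y * g y) x = pd j f x * g x + f x * pd j g x := by
  simp only [pd, fderiv_fun_mul hf hg, add_apply, smul_apply,
    smul_eq_mul]
  ring

lemma pd_add {f g : V3 → ℂ} {x : V3} (j : Fin 3) (hf : DifferentiableAt ℝ f x)
    (hg : DifferentiableAt ℝ g x) :
    pd j (fun y => f y + g y) x = pd j f x + pd j g x := by
  simp [pd, fderiv_fun_add hf hg]

lemma pd_sub {f g : V3 → ℂ} {x : V3} (j : Fin 3) (hf : DifferentiableAt ℝ f x)
    (hg : DifferentiableAt ℝ g x) :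
    pd j (fun y => f y - g y) x = pd j f x - pd j g x := by
  simp [pd, fderiv_fun_sub hf hg]

lemma pd_const (c : ℂ) (x : V3) (j : Fin 3) : pd j (fun _ => c) x = 0 := by
  simp [pd]

lemma pd_sum {ι : Type*} {s : Finset ι} {f : ι → V3 → ℂ} {x : V3} (j : Fin 3)
    (hf : ∀ i ∈ s, DifferentiableAt ℝ (f i) x) :
    pd j (fun y => ∑ i ∈ s, f i y) x = ∑ i ∈ s, pd j (f i) x := by
  simp [pd, fderiv_fun_sum hf]

lemma pd_ofReal {g : V3 → ℝ} {x : V3} (j : Fin 3) (hg : DifferentiableAt ℝ g x) :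
    pd j (fun y => (g y : ℂ)) x = (pdR j g x : ℂ) := by
  have h := (Complex.ofRealCLM.hasFDerivAt (x := g x)).comp x hg.hasFDerivAt
  have h' : fderiv ℝ (fun y => (g y : ℂ)) x = Complex.ofRealCLM.comp (fderiv ℝ g x) := h.fderiv
  simp [pd, pdR, h']

lemma pd_conj {g : V3 → ℂ} {x : V3} (j : Fin 3) (hg : DifferentiableAt ℝ g x) :
    pd j (fun y => (starRingEnd ℂ) (g y)) x = (starRingEnd ℂ) (pd j g x) := by
  have h := (Complex.conjCLE.toContinuousLinearMap.hasFDerivAt (x := g x)).comp x hg.hasFDerivAt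
  have h' : fderiv ℝ (fun y => (starRingEnd ℂ) (g y)) x
      = Complex.conjCLE.toContinuousLinearMap.comp (fderiv ℝ g x) := h.fderiv
  simp [pd, h']

lemma pd_congr {f g : V3 → ℂ} {x : V3} (j : Fin 3) (h : f =ᶠ[𝓝 x] g) : pd j f x = pd j g x := by
  simp only [pd, h.fderiv_eq]

lemma contDiffAt_pd {f : V3 → ℂ} {x : V3} (j : Fin 3) (hf : ContDiffAt ℝ 2 f x) :
    ContDiffAt ℝ 1 (pd j f) x :=
  (hf.fderiv_right (m := 1) (by norm_num)).clm_apply contDiffAt_const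

lemma contDiffAt_pdR {f : V3 → ℝ} {x : V3} (j : Fin 3) (hf : ContDiffAt ℝ 2 f x) :
    ContDiffAt ℝ 1 (pdR j f) x :=
  (hf.fderiv_right (m := 1) (by norm_num)).clm_apply contDiffAt_const

lemma differentiableAt_pd {f : V3 → ℂ} {x : V3} (j : Fin 3) (hf : ContDiffAt ℝ 2 f x) :
    DifferentiableAt ℝ (pd j f) x :=
  (contDiffAt_pd j hf).differentiableAt (by norm_num)

lemma pd_pd_comm {f : V3 → ℂ} {x : V3} (j k : Fin 3) (hf : ContDiffAt ℝ 2 f x) :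
    pd j (pd k f) x = pd k (pd j f) x := by
  have hd : DifferentiableAt ℝ (fderiv ℝ f) x :=
    (hf.fderiv_right (m := 1) (by norm_num)).differentiableAt (by norm_num)
  have key (a b : Fin 3) : pd a (pd b f) x
      = fderiv ℝ (fderiv ℝ f) x (Pi.single a 1) (Pi.single b 1) := by
    have h : fderiv ℝ (fun y => fderiv ℝ f y (Pi.single b 1)) x
        = (fderiv ℝ (fderiv ℝ f) x).flip (Pi.single b 1) := by
      rw [fderiv_clm_apply hd (differentiableAt_const _)]
      simp
    change fderiv ℝ (fun y => fderiv ℝ f y (Pi.single b 1)) x (Pi.single a 1) = _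
    rw [h]
    rfl
  rw [key, key]
  exact (hf.isSymmSndFDerivAt (by simp)).eq _ _

lemma ContDiffAt.eventually_two {E : Type*} [NormedAddCommGroup E] [NormedSpace ℝ E]
    {f : V3 → E} {x : V3} (hf : ContDiffAt ℝ 2 f x) : ∀ᶠ y in 𝓝 x, ContDiffAt ℝ 2 f y :=
  hf.eventually (by norm_num)

lemma pd_pd_mul {f g : V3 → ℂ} {x : V3} (j k : Fin 3) (hf : ContDiffAt ℝ 2 f x)
    (hg : ContDiffAt ℝ 2 g x) :
    pd j (pd k (fun y => f y * g y)) x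
      = pd j (pd k f) x * g x + pd k f x * pd j g x + pd j f x * pd k g x
        + f x * pd j (pd k g) x := by
  have h : pd k (fun y => f y * g y) =ᶠ[𝓝 x] fun y => pd k f y * g y + f y * pd k g y := by
    filter_upwards [hf.eventually_two, hg.eventually_two] with y hy hy'
    exact pd_mul k (hy.differentiableAt (by norm_num)) (hy'.differentiableAt (by norm_num))
  have hf1 := hf.differentiableAt (by norm_num)
  have hg1 := hg.differentiableAt (by norm_num)
  have hf2 := differentiableAt_pd k hf
  have hg2 := differentiableAt_pd k hg
  rw [pd_congr j h, pd_add j (hf2.fun_mul hg1) (hf1.fun_mul hg2), pd_mul j hf2 hg1,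
    pd_mul j hf1 hg2]
  ring

end PartialDerivatives

section PointwiseEquation

open Filter Topology

/-- The matrix `W(s²)` written through the square root `s` and its derivatives. -/
def sqrtW (s : V3 → ℂ) (x : V3) (i k : Fin 3) : ℂ :=
  (∑ j, pd j (pd j s) x) / s x * (if i = k then 1 else 0)
    + 2 * pd i s x * pd k s x / s x ^ 2 - 2 * pd i (pd k s) x / s x

/-- The equation `ΔΦ = VΦ` for one block, with `ε = s²`, `μ = m²` and `κ = iλ`. -/
lemma laplacian_sqrt_smul {s m : V3 → ℂ} {u v : V3 → C3} {κ : ℂ} {x : V3}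
    (hs : ContDiffAt ℝ 2 s x) (hm : ContDiffAt ℝ 2 m x)
    (hu : ∀ i, ContDiffAt ℝ 2 (fun y => u y i) x) (hv : ∀ i, ContDiffAt ℝ 2 (fun y => v y i) x)
    (hs0 : s x ≠ 0)
    (hcu : ∀ᶠ y in 𝓝 x, vcurl u y = (κ * (m y * m y)) • v y)
    (hcv : vcurl v x = (-(κ * (s x * s x))) • u x)
    (hdiv : ∀ᶠ y in 𝓝 x, vdiv (fun z => (s z * s z) • u z) y = 0) (i : Fin 3) :
    ∑ j, pd j (pd j (fun y => s y * u y i)) x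
      = ∑ k, sqrtW s x i k * (s x * u x k) + κ ^ 2 * (s x * m x) ^ 2 * (s x * u x i)
        - 2 * κ * cross (fun k => pd k (fun y => s y * m y) x) (fun k => m x * v x k) i := by
  have hs1 := hs.differentiableAt (by norm_num)
  have hm1 := hm.differentiableAt (by norm_num)
  have hu1 (i) := (hu i).differentiableAt (by norm_num)
  have hv1 (i) := (hv i).differentiableAt (by norm_num)
  have hu2 (i j) := differentiableAt_pd j (hu i)
  have hs2 (j) := differentiableAt_pd j hs
  have hD : (fun y => ∑ j, (2 * pd j s y * u y j + s y * pd j (fun z => u z j) y))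
      =ᶠ[𝓝 x] fun _ => 0 := by
    have hne : ∀ᶠ y in 𝓝 x, s y ≠ 0 := hs.continuousAt.eventually_ne hs0
    filter_upwards [hdiv, hs.eventually_two, (eventually_all.2 fun i => (hu i).eventually_two), hne]
      with y h1 h2 h3 h4
    have hsy := h2.differentiableAt (by norm_num)
    have huy (i) := (h3 i).differentiableAt (by norm_num)
    simp only [vdiv, Pi.smul_apply, smul_eq_mul] at h1
    have h5 (j) : pd j (fun z => s z * s z * u z j) y
        = s y * (2 * pd j s y * u y j + s y * pd j (fun z => u z j) y) := by
      rw [pd_mul j (hsy.fun_mul hsy) (huy j), pd_mul j hsy hsy]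
      ring
    simp only [h5, ← Finset.mul_sum] at h1
    exact (mul_eq_zero.1 h1).resolve_left h4
  have hD0 := hD.self_of_nhds
  have hD1 (k : Fin 3) : ∑ j, (2 * pd k (pd j s) x * u x j + 2 * pd j s x * pd k (fun z => u z j) x
      + pd k s x * pd j (fun z => u z j) x + s x * pd k (pd j (fun z => u z j)) x) = 0 := by
    have h := pd_congr k hD
    rw [pd_const, pd_sum] at h
    · rw [← h]
      refine Finset.sum_congr rfl fun j _ => ?_
      rw [pd_add k (((hs2 j).const_mul 2).fun_mul (hu1 j)) (hs1.fun_mul (hu2 j j)),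
        pd_mul k ((hs2 j).const_mul 2) (hu1 j), pd_mul k (differentiableAt_const _) (hs2 j),
        pd_const, pd_mul k hs1 (hu2 j j)]
      ring
    · exact fun j _ => (((hs2 j).const_mul 2).fun_mul (hu1 j)).fun_add (hs1.fun_mul (hu2 j j))
  have hcurl (a b c : Fin 3)
      (h : (fun y => pd a (fun z => u z b) y - pd b (fun z => u z a) y) =ᶠ[𝓝 x]
        fun y => κ * (m y * m y) * v y c) :
      pd a (fun z => u z b) x - pd b (fun z => u z a) x = κ * (m x * m x) * v x c ∧
      ∀ k, pd k (pd a (fun z => u z b)) x - pd k (pd b (fun z => u z a)) x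
        = κ * (2 * m x * pd k m x * v x c + m x * m x * pd k (fun z => v z c) x) := by
    refine ⟨h.self_of_nhds, fun k => ?_⟩
    have h' := pd_congr k h
    rw [pd_sub k (hu2 b a) (hu2 a b), pd_mul k ((hm1.fun_mul hm1).const_mul κ) (hv1 c),
      pd_mul k (differentiableAt_const _) (hm1.fun_mul hm1), pd_const, pd_mul k hm1 hm1] at h'
    rw [h']
    ring
  obtain ⟨c0, c0'⟩ := hcurl 1 2 0 (hcu.mono fun y h => by simpa [vcurl] using congrFun h 0)
  obtain ⟨c1, c1'⟩ := hcurl 2 0 1 (hcu.mono fun y h => by simpa [vcurl] using congrFun h 1)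
  obtain ⟨c2, c2'⟩ := hcurl 0 1 2 (hcu.mono fun y h => by simpa [vcurl] using congrFun h 2)
  have e0 : pd 1 (fun y => v y 2) x - pd 2 (fun y => v y 1) x = -(κ * (s x * s x)) * u x 0 := by
    simpa [vcurl] using congrFun hcv 0
  have e1 : pd 2 (fun y => v y 0) x - pd 0 (fun y => v y 2) x = -(κ * (s x * s x)) * u x 1 := by
    simpa [vcurl] using congrFun hcv 1
  have e2 : pd 0 (fun y => v y 1) x - pd 1 (fun y => v y 0) x = -(κ * (s x * s x)) * u x 2 := by
    simpa [vcurl] using congrFun hcv 2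
  have comm (i j k) := pd_pd_comm j k (hu i)
  simp only [pd_pd_mul _ _ hs (hu i), pd_mul _ hs1 hm1, sqrtW, cross]
  simp only [Fin.sum_univ_three] at hD0 hD1 ⊢
  have s10 := pd_pd_comm 1 0 hs
  have s20 := pd_pd_comm 2 0 hs
  have s21 := pd_pd_comm 2 1 hs
  fin_cases i
  · have d := hD1 0
    have q1 := c2' 1
    have q2 := c1' 2
    simp only [Fin.zero_eta, Fin.isValue, Matrix.cons_val, reduceIte, Fin.reduceEq]
    rw [comm 1 0 1, comm 2 0 2] at d
    field_simp
    linear_combination s x * d - pd 0 s x * hD0 - s x ^ 2 * q1 + s x ^ 2 * q2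
      - s x * 2 * pd 1 s x * c2 + s x * 2 * pd 2 s x * c1 - κ * m x ^ 2 * s x ^ 2 * e0
  · have d := hD1 1
    have q1 := c0' 2
    have q2 := c2' 0
    simp only [Fin.mk_one, Fin.isValue, Matrix.cons_val, reduceIte, Fin.reduceEq]
    rw [comm 2 1 2, comm 0 1 0] at d
    field_simp
    linear_combination s x * d - pd 1 s x * hD0 - s x ^ 2 * q1 + s x ^ 2 * q2
      - s x * 2 * pd 2 s x * c0 + s x * 2 * pd 0 s x * c2 - κ * m x ^ 2 * s x ^ 2 * e1
  · have d := hD1 2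
    have q1 := c1' 0
    have q2 := c0' 1
    simp only [Fin.reduceFinMk, Fin.isValue, Matrix.cons_val, reduceIte, Fin.reduceEq]
    rw [comm 0 2 0, comm 1 2 1] at d
    field_simp
    linear_combination s x * d - pd 2 s x * hD0 - s x ^ 2 * q1 + s x ^ 2 * q2
      - s x * 2 * pd 0 s x * c1 + s x * 2 * pd 1 s x * c0 - κ * m x ^ 2 * s x ^ 2 * e2

end PointwiseEquation

section MatrixPotential

open Filter Topology

lemma ContDiffAt.ofReal_comp {n : WithTop ℕ∞} {g : V3 → ℝ} {x : V3} (hg : ContDiffAt ℝ n g x) :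
    ContDiffAt ℝ n (fun y => (g y : ℂ)) x :=
  Complex.ofRealCLM.contDiff.contDiffAt.comp x hg

lemma pd_pd_ofReal {g : V3 → ℝ} {x : V3} (i k : Fin 3) (hg : ContDiffAt ℝ 2 g x) :
    pd i (pd k (fun y => (g y : ℂ))) x = (pdR i (fun y => pdR k g y) x : ℂ) := by
  rw [← pd_ofReal i ((contDiffAt_pdR k hg).differentiableAt (by norm_num))]
  refine pd_congr i ?_
  filter_upwards [hg.eventually_two] with y hy
  exact pd_ofReal k (hy.differentiableAt (by norm_num))

lemma eventually_ofReal_eq_sqrt_mul_sqrt {ε : V3 → ℝ} {x : V3} (hε : ContinuousAt ε x)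
    (hpos : 0 < ε x) :
    (fun y => (ε y : ℂ)) =ᶠ[𝓝 x] fun y => (Real.sqrt (ε y) : ℂ) * (Real.sqrt (ε y) : ℂ) := by
  filter_upwards [hε.eventually (lt_mem_nhds hpos)] with y hy
  rw [← Complex.ofReal_mul, Real.mul_self_sqrt hy.le]

lemma contDiffAt_ofReal_sqrt {n : WithTop ℕ∞} {ε : V3 → ℝ} {x : V3} (hε : ContDiffAt ℝ n ε x)
    (hpos : 0 < ε x) : ContDiffAt ℝ n (fun y => (Real.sqrt (ε y) : ℂ)) x :=
  (hε.sqrt hpos.ne').ofReal_comp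

lemma Wm_eq_sqrtW {ε : V3 → ℝ} {x : V3} (hε : ContDiffAt ℝ 2 ε x) (hpos : 0 < ε x)
    (i k : Fin 3) : (Wm ε x i k : ℂ) = sqrtW (fun y => (Real.sqrt (ε y) : ℂ)) x i k := by
  have he := eventually_ofReal_eq_sqrt_mul_sqrt hε.continuousAt hpos
  have hs := contDiffAt_ofReal_sqrt hε hpos
  have hs0 : (Real.sqrt (ε x) : ℂ) ≠ 0 := by exact_mod_cast (Real.sqrt_pos.2 hpos).ne'
  have h0 := he.self_of_nhds
  have h1 (j) : (pdR j ε x : ℂ)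
      = 2 * Real.sqrt (ε x) * pd j (fun y => (Real.sqrt (ε y) : ℂ)) x := by
    rw [← pd_ofReal j (hε.differentiableAt (by norm_num)), pd_congr j he,
      pd_mul j (hs.differentiableAt (by norm_num)) (hs.differentiableAt (by norm_num))]
    ring
  have h2 (j l) : (pdR j (fun y => pdR l ε y) x : ℂ)
      = 2 * pd j (fun y => (Real.sqrt (ε y) : ℂ)) x * pd l (fun y => (Real.sqrt (ε y) : ℂ)) x
        + 2 * Real.sqrt (ε x) * pd j (pd l (fun y => (Real.sqrt (ε y) : ℂ))) x := by
    have he' : pd l (fun y => (ε y : ℂ)) =ᶠ[𝓝 x]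
        pd l (fun y => (Real.sqrt (ε y) : ℂ) * (Real.sqrt (ε y) : ℂ)) := by
      filter_upwards [he.eventually_nhds] with y hy using pd_congr l hy
    rw [← pd_pd_ofReal j l hε, pd_congr j he', pd_pd_mul j l hs hs]
    ring
  simp only [Wm, sqrtW, lapR]
  push_cast
  have hδ : ((if i = k then (1 : ℝ) else 0 : ℝ) : ℂ) = if i = k then 1 else 0 := by
    split_ifs <;> simp
  simp only [h1, h2, hδ, Fin.sum_univ_three]
  simp only at h0
  rw [h0]
  field_simp
  ring

variable {ε μ : V3 → ℝ} {lam : ℝ} {u v : V3 → C3} {x : V3}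

lemma pd_sqrt_mul (hε : ContDiffAt ℝ 2 ε x) (hεpos : 0 < ε x) (k : Fin 3)
    (hμ : ContDiffAt ℝ 2 μ x) (hμpos : 0 < μ x) :
    gradC (fun y => Real.sqrt (ε y * μ y)) x k
      = pd k (fun y => (Real.sqrt (ε y) : ℂ) * (Real.sqrt (μ y) : ℂ)) x := by
  have hd : DifferentiableAt ℝ (fun y => Real.sqrt (ε y * μ y)) x :=
    ((hε.mul hμ).sqrt (mul_pos hεpos hμpos).ne').differentiableAt (by norm_num)
  rw [gradC, ← pd_ofReal k hd]
  refine pd_congr k ?_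
  filter_upwards [hε.continuousAt.eventually (lt_mem_nhds hεpos)] with y hy
  rw [Real.sqrt_mul hy.le, Complex.ofReal_mul]

lemma laplacian_Phi1 (hε : ContDiffAt ℝ 2 ε x) (hμ : ContDiffAt ℝ 2 μ x)
    (hεpos : 0 < ε x) (hμpos : 0 < μ x)
    (hu : ∀ i, ContDiffAt ℝ 2 (fun y => u y i) x) (hv : ∀ i, ContDiffAt ℝ 2 (fun y => v y i) x)
    (hequ : ∀ᶠ y in 𝓝 x, vcurl u y = (Complex.I * (lam : ℂ) * (μ y : ℂ)) • v y)
    (heqv : vcurl v x = (-(Complex.I * (lam : ℂ) * (ε x : ℂ))) • u x)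
    (hdivu : ∀ᶠ y in 𝓝 x, vdiv (fun z => (ε z : ℂ) • u z) y = 0) (i : Fin 3) :
    ∑ j, pd j (pd j (fun y => Phi1 ε u y i)) x = VPhi1 ε μ lam u v x i := by
  have hε2 := eventually_ofReal_eq_sqrt_mul_sqrt hε.continuousAt hεpos
  have hμ2 := eventually_ofReal_eq_sqrt_mul_sqrt hμ.continuousAt hμpos
  have key := laplacian_sqrt_smul (κ := Complex.I * lam) (contDiffAt_ofReal_sqrt hε hεpos)
    (contDiffAt_ofReal_sqrt hμ hμpos) hu hv
    (by exact_mod_cast (Real.sqrt_pos.2 hεpos).ne')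
    (by
      filter_upwards [hequ, hμ2] with y hy h2
      rw [hy, h2])
    (by
      rw [heqv]
      have h2 := hε2.self_of_nhds
      simp only at h2
      rw [h2])
    (by
      filter_upwards [hdivu, hε2.eventually_nhds] with y hy h2
      rw [← hy]
      refine Finset.sum_congr rfl fun j _ => pd_congr j ?_
      filter_upwards [h2] with z hz
      simp only [hz]) i
  simp only [Phi1, Pi.smul_apply, smul_eq_mul]
  rw [key]
  have hg : gradC (fun y => Real.sqrt (ε y * μ y)) x
      = fun k => pd k (fun y => (Real.sqrt (ε y) : ℂ) * (Real.sqrt (μ y) : ℂ)) x :=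
    funext fun k => pd_sqrt_mul hε hεpos k hμ hμpos
  have hp : Phi2 μ v x = fun k => (Real.sqrt (μ x) : ℂ) * v x k := rfl
  have h1 : (Real.sqrt (ε x) : ℂ) ^ 2 = ε x := by exact_mod_cast Real.sq_sqrt hεpos.le
  have h2 : (Real.sqrt (μ x) : ℂ) ^ 2 = μ x := by exact_mod_cast Real.sq_sqrt hμpos.le
  simp only [VPhi1, hg, hp, Wm_eq_sqrtW hε hεpos, Phi1, Pi.smul_apply, smul_eq_mul]
  push_cast
  rw [mul_pow, mul_pow, h1, h2, Complex.I_sq]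
  ring

/-- Maxwell's system is invariant under `(ε, μ, λ, u, v) ↦ (μ, ε, -λ, v, u)`, which swaps the two
blocks of `VΦ`. -/
lemma VPhi1_swap : VPhi1 μ ε (-lam) v u x = VPhi2 ε μ lam u v x := by
  funext j
  have h1 : Phi1 μ v = Phi2 μ v := rfl
  have h2 : Phi2 ε u = Phi1 ε u := rfl
  simp only [VPhi1, VPhi2, h1, h2, mul_comm (μ _) (ε _)]
  push_cast
  ring

lemma laplacian_Phi2 (hε : ContDiffAt ℝ 2 ε x) (hμ : ContDiffAt ℝ 2 μ x)
    (hεpos : 0 < ε x) (hμpos : 0 < μ x)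
    (hu : ∀ i, ContDiffAt ℝ 2 (fun y => u y i) x) (hv : ∀ i, ContDiffAt ℝ 2 (fun y => v y i) x)
    (hequ : vcurl u x = (Complex.I * (lam : ℂ) * (μ x : ℂ)) • v x)
    (heqv : ∀ᶠ y in 𝓝 x, vcurl v y = (-(Complex.I * (lam : ℂ) * (ε y : ℂ))) • u y)
    (hdivv : ∀ᶠ y in 𝓝 x, vdiv (fun z => (μ z : ℂ) • v z) y = 0) (i : Fin 3) :
    ∑ j, pd j (pd j (fun y => Phi2 μ v y i)) x = VPhi2 ε μ lam u v x i := by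
  rw [← VPhi1_swap]
  refine laplacian_Phi1 hμ hε hμpos hεpos hv hu ?_ ?_ hdivv i
  · filter_upwards [heqv] with y hy
    rw [hy]
    congr 1
    push_cast
    ring
  · rw [hequ]
    congr 1
    push_cast
    ring

end MatrixPotential

section CylinderDivergence

open Filter Topology Set

/-- The closed solid cylinder of radius `R`. -/
def closedCyl (R : ℝ) : Set V3 := {x | x 0 ^ 2 + x 1 ^ 2 ≤ R ^ 2}

lemma closedCyl_subset_closure {R : ℝ} (hR : 0 < R) : closedCyl R ⊆ closure (Cyl R) := by
  intro x hx
  have hc : Tendsto (fun r : ℝ => r • x) (𝓝[Ioo 0 1] 1) (𝓝 x) := by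
    have h : Continuous fun r : ℝ => r • x := by fun_prop
    simpa using (h.tendsto 1).mono_left nhdsWithin_le_nhds
  have : (𝓝[Ioo (0 : ℝ) 1] 1).NeBot := by
    rw [← mem_closure_iff_nhdsWithin_neBot, closure_Ioo (by norm_num)]
    simp
  refine mem_closure_of_tendsto hc ?_
  filter_upwards [self_mem_nhdsWithin] with r hr
  have hx' : x 0 ^ 2 + x 1 ^ 2 ≤ R ^ 2 := hx
  have hr2 : r ^ 2 < 1 := by nlinarith [hr.1, hr.2]
  have hR2 : 0 < R ^ 2 := by positivity
  change (r • x) 0 ^ 2 + (r • x) 1 ^ 2 < R ^ 2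
  simp only [Pi.smul_apply, smul_eq_mul]
  nlinarith [sq_nonneg r]

lemma isOpen_Cyl (R : ℝ) : IsOpen (Cyl R) :=
  isOpen_lt (by fun_prop) continuous_const

lemma Cyl_subset_closedCyl (R : ℝ) : Cyl R ⊆ closedCyl R := by
  intro x h
  exact le_of_lt (show x 0 ^ 2 + x 1 ^ 2 < R ^ 2 from h)

lemma bCyl_subset_closedCyl (R : ℝ) : bCyl R ⊆ closedCyl R := by
  intro x h
  exact le_of_eq (show x 0 ^ 2 + x 1 ^ 2 = R ^ 2 from h)

lemma polar_mem_bCyl (R θ t : ℝ) : ![R * Real.cos θ, R * Real.sin θ, t] ∈ bCyl R := by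
  change (R * Real.cos θ) ^ 2 + (R * Real.sin θ) ^ 2 = R ^ 2
  linear_combination R ^ 2 * Real.sin_sq_add_cos_sq θ

lemma AxialSupp.pd {g : V3 → ℂ} (hg : AxialSupp g) (j : Fin 3) : AxialSupp (pd j g) := by
  obtain ⟨T, hT, h⟩ := hg
  refine ⟨T + 1, by linarith, fun x hx => ?_⟩
  have hev : g =ᶠ[𝓝 x] fun _ => 0 := by
    have ho : IsOpen {y : V3 | T < |y 2|} := isOpen_lt continuous_const (by fun_prop)
    filter_upwards [ho.mem_nhds (show T < |x 2| by linarith)] with y hy using h y (le_of_lt hy)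
  rw [pd_congr j hev, pd_const]

lemma ContDiffAt.continuousAt_pd {g : V3 → ℂ} {x : V3} (hg : ContDiffAt ℝ 1 g x) (j : Fin 3) :
    ContinuousAt (_root_.pd j g) x :=
  ((hg.fderiv_right (m := 0) (by norm_num)).clm_apply contDiffAt_const).continuousAt

lemma hasDerivAt_comp_vec3 {g : V3 → ℂ} {a b c : ℝ → ℝ} {a' b' c' τ : ℝ}
    (hg : DifferentiableAt ℝ g ![a τ, b τ, c τ]) (ha : HasDerivAt a a' τ) (hb : HasDerivAt b b' τ)
    (hc : HasDerivAt c c' τ) :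
    HasDerivAt (fun s => g ![a s, b s, c s])
      (a' * pd 0 g ![a τ, b τ, c τ] + b' * pd 1 g ![a τ, b τ, c τ]
        + c' * pd 2 g ![a τ, b τ, c τ]) τ := by
  have hγ : HasDerivAt (fun s => (![a s, b s, c s] : V3)) ![a', b', c'] τ := by
    rw [hasDerivAt_pi]
    intro i
    fin_cases i
    · exact ha
    · exact hb
    · exact hc
  have h : HasDerivAt (fun s => g ![a s, b s, c s]) _ τ := hg.hasFDerivAt.comp_hasDerivAt τ hγ
  have hv : (![a', b', c'] : V3)
      = a' • Pi.single 0 1 + b' • Pi.single 1 1 + c' • Pi.single 2 1 := by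
    ext i
    fin_cases i <;> simp
  rw [hv, map_add, map_add, map_smul, map_smul, map_smul] at h
  simpa [pd, Complex.real_smul] using h

lemma continuous_vec3 {X : Type*} [TopologicalSpace X] {a b c : X → ℝ} (ha : Continuous a)
    (hb : Continuous b) (hc : Continuous c) : Continuous fun x => (![a x, b x, c x] : V3) := by
  refine continuous_pi fun i => ?_
  fin_cases i
  · exact ha
  · exact hb
  · exact hc

/-- The open disc of radius `R` in the plane. -/
def disc (R : ℝ) : Set (ℝ × ℝ) := {q | q.1 ^ 2 + q.2 ^ 2 < R ^ 2}

lemma measurableSet_disc (R : ℝ) : MeasurableSet (disc R) :=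
  (isOpen_lt (by fun_prop) continuous_const).measurableSet

/-- Integration over a disc in polar coordinates. -/
lemma integral_disc_eq_polar {R : ℝ} (hR : 0 < R) (h : ℝ × ℝ → ℂ) :
    ∫ q in disc R, h q
      = ∫ p in Icc ((0 : ℝ), -π) (R, π), p.1 • h (p.1 * Real.cos p.2, p.1 * Real.sin p.2) := by
  rw [← integral_indicator (measurableSet_disc R), ← integral_comp_polarCoord_symm]
  have hsub : Ioo 0 R ×ˢ Ioo (-π) π ⊆ polarCoord.target :=
    prod_mono Ioo_subset_Ioi_self subset_rfl
  have hae : (Ioo 0 R ×ˢ Ioo (-π) π : Set (ℝ × ℝ)) =ᵐ[volume] Icc ((0 : ℝ), -π) (R, π) := by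
    rw [← Icc_prod_Icc, Measure.volume_eq_prod]
    exact Measure.set_prod_ae_eq Ioo_ae_eq_Icc Ioo_ae_eq_Icc
  have hpyth (r θ : ℝ) : (r * Real.cos θ) ^ 2 + (r * Real.sin θ) ^ 2 = r ^ 2 := by
    linear_combination r ^ 2 * Real.sin_sq_add_cos_sq θ
  rw [← setIntegral_congr_set hae]
  refine (setIntegral_eq_of_subset_of_forall_sdiff_eq_zero
    polarCoord.open_target.measurableSet hsub ?_).trans
    (setIntegral_congr_fun (measurableSet_Ioo.prod measurableSet_Ioo) ?_)
  · rintro ⟨r, θ⟩ ⟨h1, h2⟩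
    have hr : 0 < r := h1.1
    have hr2 : R ≤ r := by
      by_contra! hlt
      exact h2 ⟨⟨hr, hlt⟩, h1.2⟩
    rw [indicator_of_notMem, smul_zero]
    simp only [disc, polarCoord_symm_apply, mem_ofPred_eq, not_lt, hpyth]
    nlinarith
  · rintro ⟨r, θ⟩ ⟨⟨hr, hr2⟩, -⟩
    simp only [polarCoord_symm_apply]
    rw [indicator_of_mem]
    simp only [disc, mem_ofPred_eq, hpyth]
    simp only at hr hr2
    nlinarith

/-- The divergence theorem on a disc, in the horizontal slice at height `t`. -/
lemma integral_divergence_disc {R : ℝ} (hR : 0 < R) {g₀ g₁ : V3 → ℂ}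
    (h₀ : ∀ x ∈ closedCyl R, ContDiffAt ℝ 1 g₀ x) (h₁ : ∀ x ∈ closedCyl R, ContDiffAt ℝ 1 g₁ x)
    (t : ℝ) :
    ∫ q in disc R, (pd 0 g₀ ![q.1, q.2, t] + pd 1 g₁ ![q.1, q.2, t])
      = ∫ θ in (0 : ℝ)..(2 * π), (g₀ ![R * Real.cos θ, R * Real.sin θ, t] * Real.cos θ
          + g₁ ![R * Real.cos θ, R * Real.sin θ, t] * Real.sin θ) * R := by
  let P : ℝ × ℝ → V3 := fun p => ![p.1 * Real.cos p.2, p.1 * Real.sin p.2, t]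
  have hPc : Continuous P := continuous_vec3 (by fun_prop) (by fun_prop) continuous_const
  have hPd : Differentiable ℝ P := by
    rw [differentiable_pi]
    intro i
    fin_cases i
    · change Differentiable ℝ fun p : ℝ × ℝ => p.1 * Real.cos p.2
      fun_prop
    · change Differentiable ℝ fun p : ℝ × ℝ => p.1 * Real.sin p.2
      fun_prop
    · change Differentiable ℝ fun _ : ℝ × ℝ => t
      fun_prop
  have hPm : ∀ p ∈ Icc ((0 : ℝ), -π) (R, π), P p ∈ closedCyl R := by
    rintro ⟨r, θ⟩ ⟨⟨ha, -⟩, ⟨hb, -⟩⟩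
    change (r * Real.cos θ) ^ 2 + (r * Real.sin θ) ^ 2 ≤ R ^ 2
    simp only at ha hb
    have hr2 : r ^ 2 ≤ R ^ 2 := by nlinarith
    linear_combination hr2 + r ^ 2 * Real.sin_sq_add_cos_sq θ
  let f : ℝ × ℝ → ℂ := fun p => p.1 * (g₀ (P p) * Real.cos p.2 + g₁ (P p) * Real.sin p.2)
  let g : ℝ × ℝ → ℂ := fun p => g₁ (P p) * Real.cos p.2 - g₀ (P p) * Real.sin p.2
  have hcos : Differentiable ℝ fun p : ℝ × ℝ => (Real.cos p.2 : ℂ) :=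
    Complex.ofRealCLM.differentiable.comp (Real.differentiable_cos.comp differentiable_snd)
  have hsin : Differentiable ℝ fun p : ℝ × ℝ => (Real.sin p.2 : ℂ) :=
    Complex.ofRealCLM.differentiable.comp (Real.differentiable_sin.comp differentiable_snd)
  have hfst : Differentiable ℝ fun p : ℝ × ℝ => (p.1 : ℂ) :=
    Complex.ofRealCLM.differentiable.comp (by fun_prop)
  have hgP {G : V3 → ℂ} (hG : ∀ x ∈ closedCyl R, ContDiffAt ℝ 1 G x) :
      ∀ p ∈ Icc ((0 : ℝ), -π) (R, π), DifferentiableAt ℝ (fun p => G (P p)) p := fun p hp =>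
    ((hG _ (hPm p hp)).differentiableAt (by norm_num)).comp p hPd.differentiableAt
  have hf : ∀ p ∈ Icc ((0 : ℝ), -π) (R, π), DifferentiableAt ℝ f p := fun p hp =>
    (hfst p).mul (((hgP h₀ p hp).mul (hcos p)).add ((hgP h₁ p hp).mul (hsin p)))
  have hg : ∀ p ∈ Icc ((0 : ℝ), -π) (R, π), DifferentiableAt ℝ g p := fun p hp =>
    ((hgP h₁ p hp).mul (hcos p)).sub ((hgP h₀ p hp).mul (hsin p))
  have hdiv : ∀ p ∈ Icc ((0 : ℝ), -π) (R, π), fderiv ℝ f p (1, 0) + fderiv ℝ g p (0, 1)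
      = p.1 • (pd 0 g₀ (P p) + pd 1 g₁ (P p)) := by
    rintro ⟨r, θ⟩ hp
    have d₀ := (h₀ _ (hPm _ hp)).differentiableAt (by norm_num)
    have d₁ := (h₁ _ (hPm _ hp)).differentiableAt (by norm_num)
    have hr {G : V3 → ℂ} (d : DifferentiableAt ℝ G (P (r, θ))) := hasDerivAt_comp_vec3 (τ := r)
      (a := fun s => s * Real.cos θ) (b := fun s => s * Real.sin θ) (c := fun _ => t) d
      ((hasDerivAt_id r).mul_const _) ((hasDerivAt_id r).mul_const _) (hasDerivAt_const r t)
    have hθ {G : V3 → ℂ} (d : DifferentiableAt ℝ G (P (r, θ))) := hasDerivAt_comp_vec3 (τ := θ)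
      (a := fun s => r * Real.cos s) (b := fun s => r * Real.sin s) (c := fun _ => t) d
      ((Real.hasDerivAt_cos θ).const_mul r) ((Real.hasDerivAt_sin θ).const_mul r)
      (hasDerivAt_const θ t)
    have hf₁ : HasDerivAt (fun s => f (s, θ)) (fderiv ℝ f (r, θ) (1, 0)) r :=
      HasFDerivAt.comp_hasDerivAt (l := f) r (hf _ hp).hasFDerivAt
        ((hasDerivAt_id' r).prodMk (hasDerivAt_const r θ))
    have hf₂ : HasDerivAt (fun s => f (s, θ)) _ r :=
      (hasDerivAt_id r).ofReal_comp.fun_mul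
        (((hr d₀).mul_const (Real.cos θ : ℂ)).fun_add ((hr d₁).mul_const (Real.sin θ : ℂ)))
    have hg₁ : HasDerivAt (fun s => g (r, s)) (fderiv ℝ g (r, θ) (0, 1)) θ :=
      (hg _ hp).hasFDerivAt.comp_hasDerivAt θ ((hasDerivAt_const θ r).prodMk (hasDerivAt_id' θ))
    have hg₂ : HasDerivAt (fun s => g (r, s)) _ θ :=
      ((hθ d₁).fun_mul (Real.hasDerivAt_cos θ).ofReal_comp).fun_sub
        ((hθ d₀).fun_mul (Real.hasDerivAt_sin θ).ofReal_comp)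
    rw [hf₁.unique hf₂, hg₁.unique hg₂]
    have hcs : (Real.cos θ : ℂ) ^ 2 + (Real.sin θ : ℂ) ^ 2 = 1 := by
      exact_mod_cast Real.cos_sq_add_sin_sq θ
    simp only [id, Complex.real_smul, P]
    push_cast at hcs ⊢
    linear_combination (r * (pd 0 g₀ (P (r, θ)) + pd 1 g₁ (P (r, θ)))) * hcs
  have hint : IntegrableOn (fun p => fderiv ℝ f p (1, 0) + fderiv ℝ g p (0, 1))
      (Icc ((0 : ℝ), -π) (R, π)) := by
    refine (ContinuousOn.integrableOn_compact isCompact_Icc ?_).congr_fun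
      (fun p hp => (hdiv p hp).symm) measurableSet_Icc
    refine continuousOn_fst.smul (ContinuousOn.add ?_ ?_)
    · exact fun p hp => (((h₀ _ (hPm p hp)).continuousAt_pd 0).comp
        hPc.continuousAt).continuousWithinAt
    · exact fun p hp => (((h₁ _ (hPm p hp)).continuousAt_pd 1).comp
        hPc.continuousAt).continuousWithinAt
  have hin : ∀ p ∈ Ioo (0 : ℝ) R ×ˢ Ioo (-π) π, p ∈ Icc ((0 : ℝ), -π) (R, π) := by
    rintro p ⟨⟨a, b⟩, ⟨c, d⟩⟩
    exact ⟨⟨a.le, c.le⟩, ⟨b.le, d.le⟩⟩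
  have key := integral_divergence_prod_Icc_of_hasFDerivAt_of_le f g (fderiv ℝ f) (fderiv ℝ g)
    ((0 : ℝ), -π) (R, π) ⟨hR.le, by simp only; linarith [Real.pi_pos]⟩
    (fun p hp => (hf p hp).continuousAt.continuousWithinAt)
    (fun p hp => (hg p hp).continuousAt.continuousWithinAt)
    (fun p hp => (hf p (hin p hp)).hasFDerivAt) (fun p hp => (hg p (hin p hp)).hasFDerivAt) hint
  rw [integral_disc_eq_polar hR]
  rw [setIntegral_congr_fun measurableSet_Icc hdiv] at key
  refine key.trans ?_
  have hz : ∫ θ in (-π)..π, f (0, θ) = 0 := by simp [f]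
  have hgg : (∫ r in (0 : ℝ)..R, g (r, π)) = ∫ r in (0 : ℝ)..R, g (r, -π) := by
    simp [g, P]
  simp only [hz, hgg, sub_self, zero_add, sub_zero]
  have hper : Function.Periodic (fun θ => f (R, θ)) (2 * π) := fun θ => by
    simp only [f, P, Real.cos_add_two_pi, Real.sin_add_two_pi]
  have h2 := hper.intervalIntegral_add_eq (-π) 0
  rw [show -π + 2 * π = π by ring, zero_add] at h2
  rw [h2]
  refine intervalIntegral.integral_congr fun θ _ => ?_
  simp only [f, P]
  ring

end CylinderDivergence

section CylinderFubini

open Filter Topology Set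

/-- Splitting off the axial coordinate of a point of space. -/
def axialEquiv : V3 ≃ᵐ ℝ × (ℝ × ℝ) :=
  (MeasurableEquiv.piFinSuccAbove (fun _ : Fin 3 => ℝ) 2).trans
    ((MeasurableEquiv.refl ℝ).prodCongr MeasurableEquiv.finTwoArrow)

lemma axialEquiv_apply (x : V3) : axialEquiv x = (x 2, (x 0, x 1)) := rfl

lemma measurePreserving_axialEquiv : MeasurePreserving axialEquiv :=
  ((MeasurePreserving.id (volume : Measure ℝ)).prod (volume_preserving_finTwoArrow ℝ)).comp
    (volume_preserving_piFinSuccAbove (fun _ : Fin 3 => ℝ) 2)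

lemma setIntegral_Cyl (R : ℝ) (F : V3 → ℂ) :
    ∫ x in Cyl R, F x = ∫ q in (univ : Set ℝ) ×ˢ disc R, F ![q.2.1, q.2.2, q.1] := by
  rw [← measurePreserving_axialEquiv.setIntegral_preimage_emb axialEquiv.measurableEmbedding]
  have hpre : axialEquiv ⁻¹' ((univ : Set ℝ) ×ˢ disc R) = Cyl R := by
    ext x
    simp [axialEquiv_apply, disc, Cyl]
  rw [hpre]
  congr 1
  funext x
  congr 1
  ext i
  fin_cases i <;> rfl

lemma integrableOn_univ_prod_disc {R : ℝ} {h : V3 → ℂ}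
    (hc : ∀ x ∈ closedCyl R, ContinuousAt h x) (hs : AxialSupp h) :
    IntegrableOn (fun q : ℝ × (ℝ × ℝ) => h ![q.2.1, q.2.2, q.1]) ((univ : Set ℝ) ×ˢ disc R) := by
  obtain ⟨T, -, hT⟩ := hs
  let D : Set (ℝ × ℝ) := {q | q.1 ^ 2 + q.2 ^ 2 ≤ R ^ 2}
  have hDsub : D ⊆ Icc (-|R|, -|R|) (|R|, |R|) := by
    rintro ⟨a, b⟩ hab
    have hab' : a ^ 2 + b ^ 2 ≤ R ^ 2 := hab
    have ha := abs_le.1 (sq_le_sq.1 (by nlinarith [sq_nonneg b] : a ^ 2 ≤ R ^ 2))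
    have hb := abs_le.1 (sq_le_sq.1 (by nlinarith [sq_nonneg a] : b ^ 2 ≤ R ^ 2))
    exact ⟨⟨ha.1, hb.1⟩, ⟨ha.2, hb.2⟩⟩
  have hD : IsCompact D :=
    isCompact_Icc.of_isClosed_subset (isClosed_le (by fun_prop) continuous_const) hDsub
  have hP : Continuous fun q : ℝ × (ℝ × ℝ) => (![q.2.1, q.2.2, q.1] : V3) :=
    continuous_vec3 (by fun_prop) (by fun_prop) (by fun_prop)
  have hcpt : IntegrableOn (fun q : ℝ × (ℝ × ℝ) => h ![q.2.1, q.2.2, q.1])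
      (Icc (-T) T ×ˢ D) := by
    refine ContinuousOn.integrableOn_compact (isCompact_Icc.prod hD) fun q hq => ?_
    exact ((hc _ (show q.2.1 ^ 2 + q.2.2 ^ 2 ≤ R ^ 2 from hq.2)).comp
      (f := fun q : ℝ × (ℝ × ℝ) => (![q.2.1, q.2.2, q.1] : V3))
      hP.continuousAt).continuousWithinAt
  refine hcpt.of_forall_sdiff_eq_zero (MeasurableSet.univ.prod (measurableSet_disc R)) ?_
  rintro ⟨t, a, b⟩ ⟨⟨-, h1⟩, h2⟩
  refine hT _ ?_
  change T ≤ |t|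
  by_contra! hlt
  exact h2 ⟨abs_le.1 hlt.le, le_of_lt (show a ^ 2 + b ^ 2 < R ^ 2 from h1)⟩

lemma integral_axial_pd_eq_zero {g : V3 → ℂ} {a b : ℝ}
    (hg : ∀ t : ℝ, ContDiffAt ℝ 1 g ![a, b, t]) (hs : AxialSupp g) :
    ∫ t : ℝ, pd 2 g ![a, b, t] = 0 := by
  have hP : Continuous fun t : ℝ => (![a, b, t] : V3) :=
    continuous_vec3 continuous_const continuous_const continuous_id
  have hint {h : V3 → ℂ} (hh : AxialSupp h) (hc : ∀ t : ℝ, ContinuousAt h ![a, b, t]) :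
      Integrable fun t : ℝ => h ![a, b, t] := by
    obtain ⟨T, -, hT⟩ := hh
    refine Continuous.integrable_of_hasCompactSupport
      (continuous_iff_continuousAt.2 fun t => ContinuousAt.comp (hc t) hP.continuousAt) ?_
    refine HasCompactSupport.intro (isCompact_Icc (a := -T) (b := T)) fun t ht => hT _ ?_
    change T ≤ |t|
    by_contra! hlt
    exact ht (abs_le.1 hlt.le)
  refine integral_eq_zero_of_hasDerivAt_of_integrable (f := fun t => g ![a, b, t]) (fun t => ?_)
    (hint (hs.pd 2) fun t => (hg t).continuousAt_pd 2) (hint hs fun t => (hg t).continuousAt)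
  simpa using hasDerivAt_comp_vec3 ((hg t).differentiableAt (by norm_num)) (hasDerivAt_const t a)
    (hasDerivAt_const t b) (hasDerivAt_id' t)

/-- The divergence theorem on the infinite circular cylinder. -/
theorem integral_divergence_Cyl {R : ℝ} (hR : 0 < R) {G : Fin 3 → V3 → ℂ}
    (hG : ∀ j, ∀ x ∈ closedCyl R, ContDiffAt ℝ 1 (G j) x) (hs : ∀ j, AxialSupp (G j)) :
    ∫ x in Cyl R, ∑ j, pd j (G j) x = surfInt R (fun x => ∑ j, G j x * (nuR R x j : ℂ)) := by
  have hI (j) := integrableOn_univ_prod_disc (fun x hx => (hG j x hx).continuousAt_pd j)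
    ((hs j).pd j)
  rw [setIntegral_Cyl]
  simp only [Fin.sum_univ_three]
  have hz : ∫ q in (univ : Set ℝ) ×ˢ disc R, pd 2 (G 2) ![q.2.1, q.2.2, q.1] = 0 := by
    have h2 := hI 2
    rw [IntegrableOn, Measure.volume_eq_prod, ← Measure.prod_restrict] at h2
    rw [Measure.volume_eq_prod, ← Measure.prod_restrict, integral_prod_symm _ h2]
    rw [Measure.restrict_univ]
    refine setIntegral_eq_zero_of_forall_eq_zero fun q hq => ?_
    exact integral_axial_pd_eq_zero (fun t => hG 2 _
      (le_of_lt (show q.1 ^ 2 + q.2 ^ 2 < R ^ 2 from hq))) (hs 2)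
  have h01 : IntegrableOn (fun q : ℝ × (ℝ × ℝ) =>
      pd 0 (G 0) ![q.2.1, q.2.2, q.1] + pd 1 (G 1) ![q.2.1, q.2.2, q.1])
      ((univ : Set ℝ) ×ˢ disc R) := (hI 0).add (hI 1)
  rw [integral_add h01 (hI 2), hz, add_zero]
  rw [Measure.volume_eq_prod, setIntegral_prod _ h01, Measure.restrict_univ, surfInt]
  congr 1
  funext t
  refine (integral_divergence_disc hR (hG 0) (hG 1) t).trans ?_
  refine intervalIntegral.integral_congr fun θ _ => ?_
  have hR' : (R : ℂ) ≠ 0 := by exact_mod_cast hR.ne'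
  simp only [nuR, Matrix.cons_val]
  push_cast
  field_simp
  simp

end CylinderFubini

section BoundaryConditions

open Filter Topology Set

lemma eq_zero_of_forall_Cyl {R : ℝ} (hR : 0 < R) {h : V3 → ℂ} {x : V3} (hx : x ∈ closedCyl R)
    (hc : ContinuousAt h x) (h0 : ∀ y ∈ Cyl R, h y = 0) : h x = 0 := by
  have := mem_closure_iff_nhdsWithin_neBot.1 (closedCyl_subset_closure hR hx)
  refine tendsto_nhds_unique (hc.tendsto.mono_left (nhdsWithin_le_nhds (s := Cyl R))) ?_
  refine tendsto_const_nhds.congr' ?_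
  filter_upwards [self_mem_nhdsWithin] with y hy using (h0 y hy).symm

lemma ofReal_cos_sq_add_sin_sq (θ : ℝ) : (Real.cos θ : ℂ) ^ 2 + (Real.sin θ : ℂ) ^ 2 = 1 := by
  exact_mod_cast Real.cos_sq_add_sin_sq θ

lemma hasDerivAt_angular {g : V3 → ℂ} {R θ t : ℝ}
    (hg : DifferentiableAt ℝ g ![R * Real.cos θ, R * Real.sin θ, t]) :
    HasDerivAt (fun τ => g ![R * Real.cos τ, R * Real.sin τ, t])
      (R * (Real.cos θ * pd 1 g ![R * Real.cos θ, R * Real.sin θ, t]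
        - Real.sin θ * pd 0 g ![R * Real.cos θ, R * Real.sin θ, t])) θ := by
  refine (hasDerivAt_comp_vec3 hg ((Real.hasDerivAt_cos θ).const_mul R)
    ((Real.hasDerivAt_sin θ).const_mul R) (hasDerivAt_const θ t)).congr_deriv ?_
  push_cast
  ring

lemma hasDerivAt_axial {g : V3 → ℂ} {a b t : ℝ} (hg : DifferentiableAt ℝ g ![a, b, t]) :
    HasDerivAt (fun τ => g ![a, b, τ]) (pd 2 g ![a, b, t]) t := by
  simpa using hasDerivAt_comp_vec3 hg (hasDerivAt_const t a) (hasDerivAt_const t b)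
    (hasDerivAt_id' t)

lemma nuR_polar {R : ℝ} (hR : 0 < R) (θ t : ℝ) :
    nuR R ![R * Real.cos θ, R * Real.sin θ, t] = ![Real.cos θ, Real.sin θ, 0] := by
  have hR' := hR.ne'
  simp [nuR, hR']

lemma ncomp_polar {R : ℝ} (hR : 0 < R) (θ t : ℝ) (z : C3) :
    ncomp R ![R * Real.cos θ, R * Real.sin θ, t] z
      = z 0 * Real.cos θ + z 1 * Real.sin θ := by
  simp [ncomp, nuR_polar hR, Fin.sum_univ_three]

lemma normal_components {R : ℝ} (hR : 0 < R) {u : V3 → C3} {θ t : ℝ}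
    (h : ∀ x ∈ bCyl R, ∀ i, u x i = ncomp R x (u x) * (nuR R x i : ℂ)) :
    let x : V3 := ![R * Real.cos θ, R * Real.sin θ, t]
    u x 0 = (u x 0 * Real.cos θ + u x 1 * Real.sin θ) * Real.cos θ ∧
      u x 1 = (u x 0 * Real.cos θ + u x 1 * Real.sin θ) * Real.sin θ ∧ u x 2 = 0 := by
  intro x
  have h' := h x (polar_mem_bCyl R θ t)
  simp only [x, ncomp_polar hR, nuR_polar hR] at h' ⊢
  exact ⟨by simpa using h' 0, by simpa using h' 1, by simpa using h' 2⟩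

lemma tangential_components {R : ℝ} (hR : 0 < R) {v : V3 → C3} {θ t : ℝ}
    (h : ∀ x ∈ bCyl R, ncomp R x (v x) = 0) :
    v ![R * Real.cos θ, R * Real.sin θ, t] 0 * Real.cos θ
      + v ![R * Real.cos θ, R * Real.sin θ, t] 1 * Real.sin θ = 0 := by
  rw [← h _ (polar_mem_bCyl R θ t), ncomp_polar hR]

/-- The normal component of the normal derivative of a field which is normal on the boundary and
satisfies `div (eu) = 0`. -/
lemma normal_deriv_of_normal {R : ℝ} (hR : 0 < R) {e : V3 → ℂ} {u : V3 → C3}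
    (he : ∀ x ∈ closedCyl R, ContDiffAt ℝ 1 e x)
    (hu : ∀ i, ∀ x ∈ closedCyl R, ContDiffAt ℝ 1 (fun y => u y i) x)
    (hdiv : ∀ x ∈ Cyl R, vdiv (fun y => e y • u y) x = 0)
    (hbc : ∀ x ∈ bCyl R, ∀ i, u x i = ncomp R x (u x) * (nuR R x i : ℂ)) (θ t : ℝ) :
    let x : V3 := ![R * Real.cos θ, R * Real.sin θ, t]
    let ν : Fin 3 → ℂ := ![Real.cos θ, Real.sin θ, 0]
    R * e x * (∑ i, (∑ j, pd j (fun y => u y i) x * ν j) * ν i) + e x * (∑ i, u x i * ν i)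
      + R * (∑ j, pd j e x * ν j) * (∑ i, u x i * ν i) = 0 := by
  intro x ν
  have hx : x ∈ closedCyl R := bCyl_subset_closedCyl R (polar_mem_bCyl R θ t)
  have hu1 (i) := (hu i x hx).differentiableAt (by norm_num)
  have hd : ∑ j, (pd j e x * u x j + e x * pd j (fun y => u y j) x) = 0 := by
    refine eq_zero_of_forall_Cyl hR (h := fun x =>
      ∑ j, (pd j e x * u x j + e x * pd j (fun y => u y j) x)) hx ?_ fun y hy => ?_
    · exact tendsto_finsetSum _ fun j _ =>
        (((he x hx).continuousAt_pd j).mul (hu j x hx).continuousAt).add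
          ((he x hx).continuousAt.mul ((hu j x hx).continuousAt_pd j))
    · rw [← hdiv y hy, vdiv]
      have hy' := Cyl_subset_closedCyl R hy
      exact Finset.sum_congr rfl fun j _ => (pd_mul j ((he y hy').differentiableAt (by norm_num))
        ((hu j y hy').differentiableAt (by norm_num))).symm
  have hcs := ofReal_cos_sq_add_sin_sq θ
  obtain ⟨h0, h1, h2⟩ : _ ∧ _ ∧ _ := normal_components hR (θ := θ) (t := t) hbc
  have htan := (((hasDerivAt_angular (hu1 1)).fun_mul (Real.hasDerivAt_cos θ).ofReal_comp).fun_sub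
    ((hasDerivAt_angular (hu1 0)).fun_mul (Real.hasDerivAt_sin θ).ofReal_comp)).unique
    ((hasDerivAt_const θ (0 : ℂ)).congr_of_eventuallyEq (.of_forall fun τ => by
      obtain ⟨k0, k1, -⟩ : _ ∧ _ ∧ _ := normal_components hR (θ := τ) (t := t) hbc
      simp only
      linear_combination Real.cos τ * k1 - Real.sin τ * k0))
  have hax := (hasDerivAt_axial (hu1 2)).unique
    ((hasDerivAt_const t (0 : ℂ)).congr_of_eventuallyEq (.of_forall fun τ =>
      (normal_components hR (θ := θ) (t := τ) hbc).2.2))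
  change pd 2 (fun y => u y 2) x = 0 at hax
  rw [Complex.ofReal_neg] at htan
  change u x 2 = 0 at h2
  change u x 0 = (u x 0 * Real.cos θ + u x 1 * Real.sin θ) * Real.cos θ at h0
  change u x 1 = (u x 0 * Real.cos θ + u x 1 * Real.sin θ) * Real.sin θ at h1
  change R * (Real.cos θ * pd 1 (fun y => u y 1) x - Real.sin θ * pd 0 (fun y => u y 1) x)
      * Real.cos θ + u x 1 * -Real.sin θ
    - (R * (Real.cos θ * pd 1 (fun y => u y 0) x - Real.sin θ * pd 0 (fun y => u y 0) x)
      * Real.sin θ + u x 0 * Real.cos θ) = 0 at htan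
  simp only [Fin.sum_univ_three, ν, Matrix.cons_val] at hd ⊢
  rw [h2, hax] at hd
  simp only [mul_zero, add_zero]
  linear_combination R * hd - e x * htan - R * pd 0 e x * h0 - R * pd 1 e x * h1
    + R * e x * (pd 0 (fun y => u y 0) x + pd 1 (fun y => u y 1) x) * hcs

/-- The tangential part of the normal derivative of a field which is tangential on the boundary and
whose curl is normal there. -/
lemma normal_deriv_of_tangential {R : ℝ} (hR : 0 < R) {k : V3 → ℂ} {u v : V3 → C3}
    (hk : ∀ x ∈ closedCyl R, ContinuousAt k x)
    (hu : ∀ i, ∀ x ∈ closedCyl R, ContinuousAt (fun y => u y i) x)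
    (hv : ∀ i, ∀ x ∈ closedCyl R, ContDiffAt ℝ 1 (fun y => v y i) x)
    (hcurl : ∀ x ∈ Cyl R, vcurl v x = k x • u x)
    (hubc : ∀ x ∈ bCyl R, ∀ i, u x i = ncomp R x (u x) * (nuR R x i : ℂ))
    (hvbc : ∀ x ∈ bCyl R, ncomp R x (v x) = 0) (θ t : ℝ) :
    let x : V3 := ![R * Real.cos θ, R * Real.sin θ, t]
    let ν : Fin 3 → ℂ := ![Real.cos θ, Real.sin θ, 0]
    R * (Real.cos θ * (∑ j, pd j (fun y => v y 1) x * ν j)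
        - Real.sin θ * (∑ j, pd j (fun y => v y 0) x * ν j))
      + (Real.cos θ * v x 1 - Real.sin θ * v x 0) = 0 ∧
    ∑ j, pd j (fun y => v y 2) x * ν j = 0 := by
  intro x ν
  have hx : x ∈ closedCyl R := bCyl_subset_closedCyl R (polar_mem_bCyl R θ t)
  have hv1 (i) := (hv i x hx).differentiableAt (by norm_num)
  have hc (a b c : Fin 3)
      (h : ∀ y ∈ Cyl R, pd a (fun z => v z b) y - pd b (fun z => v z a) y - k y * u y c = 0) :
      pd a (fun z => v z b) x - pd b (fun z => v z a) x - k x * u x c = 0 :=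
    eq_zero_of_forall_Cyl hR (h := fun y =>
        pd a (fun z => v z b) y - pd b (fun z => v z a) y - k y * u y c) hx
      ((((hv b x hx).continuousAt_pd a).sub ((hv a x hx).continuousAt_pd b)).sub
        ((hk x hx).mul (hu c x hx))) h
  have c0 := hc 1 2 0 fun y hy => sub_eq_zero.2 (by simpa [vcurl] using congrFun (hcurl y hy) 0)
  have c1 := hc 2 0 1 fun y hy => sub_eq_zero.2 (by simpa [vcurl] using congrFun (hcurl y hy) 1)
  have c2 := hc 0 1 2 fun y hy => sub_eq_zero.2 (by simpa [vcurl] using congrFun (hcurl y hy) 2)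
  have hcs := ofReal_cos_sq_add_sin_sq θ
  obtain ⟨h0, h1, h2⟩ : _ ∧ _ ∧ _ := normal_components hR (θ := θ) (t := t) hubc
  have hang := (((hasDerivAt_angular (hv1 0)).fun_mul (Real.hasDerivAt_cos θ).ofReal_comp).fun_add
    ((hasDerivAt_angular (hv1 1)).fun_mul (Real.hasDerivAt_sin θ).ofReal_comp)).unique
    ((hasDerivAt_const θ (0 : ℂ)).congr_of_eventuallyEq (.of_forall fun τ =>
      tangential_components hR (θ := τ) (t := t) hvbc))
  have hax := (((hasDerivAt_axial (hv1 0)).mul_const (Real.cos θ : ℂ)).fun_add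
    ((hasDerivAt_axial (hv1 1)).mul_const (Real.sin θ : ℂ))).unique
    ((hasDerivAt_const t (0 : ℂ)).congr_of_eventuallyEq (.of_forall fun τ =>
      tangential_components hR (θ := θ) (t := τ) hvbc))
  rw [Complex.ofReal_neg] at hang
  change u x 2 = 0 at h2
  change u x 0 = (u x 0 * Real.cos θ + u x 1 * Real.sin θ) * Real.cos θ at h0
  change u x 1 = (u x 0 * Real.cos θ + u x 1 * Real.sin θ) * Real.sin θ at h1
  change R * (Real.cos θ * pd 1 (fun y => v y 0) x - Real.sin θ * pd 0 (fun y => v y 0) x)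
      * Real.cos θ + v x 0 * -Real.sin θ
    + (R * (Real.cos θ * pd 1 (fun y => v y 1) x - Real.sin θ * pd 0 (fun y => v y 1) x)
      * Real.sin θ + v x 1 * Real.cos θ) = 0 at hang
  change pd 2 (fun y => v y 0) x * Real.cos θ + pd 2 (fun y => v y 1) x * Real.sin θ = 0 at hax
  rw [h2] at c2
  simp only [Fin.sum_univ_three, ν, Matrix.cons_val]
  refine ⟨?_, ?_⟩
  · linear_combination hang + R * (Real.cos θ ^ 2 + Real.sin θ ^ 2) * c2
  · linear_combination hax + Real.sin θ * c0 - Real.cos θ * c1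
      + k x * (Real.sin θ * h0 - Real.cos θ * h1)

end BoundaryConditions

section Flux

open Filter Topology Set

lemma UpTo.contDiffAt {E : Type*} [NormedAddCommGroup E] [NormedSpace ℝ E] {R : ℝ} {k : ℕ}
    {g : V3 → E} (hg : UpTo k (Cyl R) g) (hR : 0 < R) {x : V3} (hx : x ∈ closedCyl R) :
    ContDiffAt ℝ k g x := by
  obtain ⟨U, hU, hsub, h⟩ := hg
  exact h.contDiffAt (hU.mem_nhds (hsub (closedCyl_subset_closure hR hx)))

lemma UpTo.contDiffAt_apply {R : ℝ} {k : ℕ} {g : V3 → C3} (hg : UpTo k (Cyl R) g) (hR : 0 < R)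
    {x : V3} (hx : x ∈ closedCyl R) (i : Fin 3) : ContDiffAt ℝ k (fun y => g y i) x :=
  contDiffAt_pi.1 (hg.contDiffAt hR hx) i

lemma AxialSupp.sum {ι : Type*} {s : Finset ι} {g : ι → V3 → ℂ}
    (hg : ∀ i, AxialSupp (g i)) : AxialSupp fun x => ∑ i ∈ s, g i x := by
  choose T hT h using hg
  refine ⟨1 + ∑ i ∈ s, T i, by linarith [Finset.sum_nonneg fun i (_ : i ∈ s) => (hT i).le],
    fun x hx => Finset.sum_eq_zero fun i hi => h i x ?_⟩
  linarith [Finset.single_le_sum (fun i (_ : i ∈ s) => (hT i).le) hi]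

lemma AxialSupp.add {g h : V3 → ℂ} (hg : AxialSupp g) (hh : AxialSupp h) :
    AxialSupp fun x => g x + h x := by
  obtain ⟨S, hS, hgz⟩ := hg
  obtain ⟨T, -, hhz⟩ := hh
  exact ⟨max S T, lt_max_of_lt_left hS, fun x hx => by
    simp [hgz x (le_of_max_le_left hx), hhz x (le_of_max_le_right hx)]⟩

lemma AxialSupp.mul_right {g : V3 → ℂ} (hg : AxialSupp g) (h : V3 → ℂ) :
    AxialSupp fun x => g x * h x := by
  obtain ⟨T, hT, hz⟩ := hg
  exact ⟨T, hT, fun x hx => by simp [hz x hx]⟩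

lemma AxialSupp.smul_apply {c : V3 → ℂ} {g : V3 → C3} (hg : AxialSupp g) (i : Fin 3) :
    AxialSupp fun x => (c x • g x) i := by
  obtain ⟨T, hT, hz⟩ := hg
  exact ⟨T, hT, fun x hx => by simp [hz x hx]⟩

lemma contDiffAt_conj {n : WithTop ℕ∞} {g : V3 → ℂ} {x : V3} (hg : ContDiffAt ℝ n g x) :
    ContDiffAt ℝ n (fun y => (starRingEnd ℂ) (g y)) x :=
  Complex.conjCLE.contDiff.contDiffAt.comp x hg

/-- The flux `Σᵢ (∂ⱼΦᵢ) · conj Ψᵢ` in the direction `j`. -/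
def flux (φ ψ : V3 → C3) (j : Fin 3) (x : V3) : ℂ := hinner (pdV j φ x) (ψ x)

variable {φ ψ : V3 → C3} {x : V3}

lemma contDiffAt_flux (hφ : ∀ i, ContDiffAt ℝ 2 (fun y => φ y i) x)
    (hψ : ∀ i, ContDiffAt ℝ 2 (fun y => ψ y i) x) (j : Fin 3) :
    ContDiffAt ℝ 1 (flux φ ψ j) x :=
  ContDiffAt.sum (s := Finset.univ) fun i _ =>
    (contDiffAt_pd j (hφ i)).mul (contDiffAt_conj ((hψ i).of_le (by norm_num)))

lemma axialSupp_flux (hφ : ∀ i, AxialSupp fun y => φ y i) (j : Fin 3) :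
    AxialSupp (flux φ ψ j) :=
  AxialSupp.sum (s := Finset.univ) fun i => ((hφ i).pd j).mul_right fun y => (starRingEnd ℂ) (ψ y i)

lemma sum_pd_flux (hφ : ∀ i, ContDiffAt ℝ 2 (fun y => φ y i) x)
    (hψ : ∀ i, ContDiffAt ℝ 2 (fun y => ψ y i) x) :
    ∑ j, pd j (flux φ ψ j) x = (∑ j, hinner (pdV j φ x) (pdV j ψ x))
      + hinner (fun i => ∑ j, pd j (pd j (fun y => φ y i)) x) (ψ x) := by
  have h (j : Fin 3) : pd j (flux φ ψ j) x = hinner (pdV j φ x) (pdV j ψ x)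
      + ∑ i, pd j (pd j (fun y => φ y i)) x * (starRingEnd ℂ) (ψ x i) := by
    have hψ1 (i) := (hψ i).differentiableAt (by norm_num)
    have hψc (i) := (contDiffAt_conj (hψ i)).differentiableAt (by norm_num)
    have hd (i) := differentiableAt_pd j (hφ i)
    change pd j (fun y => ∑ i, pd j (fun y => φ y i) y * (starRingEnd ℂ) (ψ y i)) x = _
    rw [pd_sum j fun i _ => (hd i).fun_mul (hψc i), hinner, ← Finset.sum_add_distrib]
    refine Finset.sum_congr rfl fun i _ => ?_
    rw [pd_mul j (hd i) (hψc i), pd_conj j (hψ1 i), pdV, pdV, add_comm]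
  simp only [h, Finset.sum_add_distrib, hinner, Finset.sum_mul]
  congr 1
  exact Finset.sum_comm

variable {ε μ : V3 → ℝ}

lemma contDiffAt_Phi1 {u : V3 → C3} (hε : ContDiffAt ℝ 2 ε x) (hεpos : 0 < ε x)
    (hu : ∀ i, ContDiffAt ℝ 2 (fun y => u y i) x) (i : Fin 3) :
    ContDiffAt ℝ 2 (fun y => Phi1 ε u y i) x :=
  (contDiffAt_ofReal_sqrt hε hεpos).mul (hu i)

lemma contDiffAt_Psi1 {w : V3 → C3} (hε : ContDiffAt ℝ 2 ε x) (hεpos : 0 < ε x)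
    (hμ : ContDiffAt ℝ 2 μ x) (hμpos : 0 < μ x)
    (hw : ∀ i, ContDiffAt ℝ 2 (fun y => w y i) x) (i : Fin 3) :
    ContDiffAt ℝ 2 (fun y => Psi1 ε μ w y i) x :=
  (((hε.sqrt hεpos.ne').inv (Real.sqrt_pos.2 hεpos).ne').mul
    (hμ.inv hμpos.ne')).ofReal_comp.mul (hw i)

lemma contDiffAt_Psi2 {f : V3 → C3} (hε : ContDiffAt ℝ 2 ε x) (hεpos : 0 < ε x)
    (hμ : ContDiffAt ℝ 2 μ x) (hμpos : 0 < μ x)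
    (hf : ∀ i, ContDiffAt ℝ 2 (fun y => f y i) x) (i : Fin 3) :
    ContDiffAt ℝ 2 (fun y => Psi2 ε μ f y i) x :=
  ((hε.inv hεpos.ne').mul
    ((hμ.sqrt hμpos.ne').inv (Real.sqrt_pos.2 hμpos).ne')).ofReal_comp.mul (hf i)

lemma surfInt_neg (R : ℝ) (F : V3 → ℂ) : surfInt R (fun x => -F x) = -surfInt R F := by
  simp only [surfInt, neg_mul, intervalIntegral.integral_neg, integral_neg]

lemma pd_Phi1 {u : V3 → C3} (hε : ContDiffAt ℝ 2 ε x) (hεpos : 0 < ε x)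
    (hu : ∀ i, ContDiffAt ℝ 2 (fun y => u y i) x) (i j : Fin 3) :
    pd j (fun y => Phi1 ε u y i) x
      = Real.sqrt (ε x) * ((2 * ε x : ℂ)⁻¹ * pdR j ε x * u x i + pd j (fun y => u y i) x) := by
  have hs := (contDiffAt_ofReal_sqrt hε hεpos).differentiableAt (by norm_num)
  have h := pd_congr j (eventually_ofReal_eq_sqrt_mul_sqrt hε.continuousAt hεpos)
  rw [pd_ofReal j (hε.differentiableAt (by norm_num)), pd_mul j hs hs] at h
  have h1 : (Real.sqrt (ε x) : ℂ) ^ 2 = ε x := by exact_mod_cast Real.sq_sqrt hεpos.le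
  have h0 : (ε x : ℂ) ≠ 0 := by exact_mod_cast hεpos.ne'
  refine (pd_mul j hs ((hu i).differentiableAt (by norm_num))).trans ?_
  rw [h]
  field_simp
  linear_combination (-2 * pd j (fun y => (Real.sqrt (ε y) : ℂ)) x * u x i) * h1

/-- The boundary flux of a field which is normal on the boundary. -/
lemma flux_normal {R : ℝ} (hR : 0 < R) {u w : V3 → C3}
    (hε : ∀ x ∈ closedCyl R, ContDiffAt ℝ 2 ε x) (hεpos : ∀ x ∈ closedCyl R, 0 < ε x)
    (hu : ∀ i, ∀ x ∈ closedCyl R, ContDiffAt ℝ 2 (fun y => u y i) x)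
    (hdiv : ∀ x ∈ Cyl R, vdiv (fun y => (ε y : ℂ) • u y) x = 0)
    (hubc : ∀ x ∈ bCyl R, ∀ i, u x i = ncomp R x (u x) * (nuR R x i : ℂ))
    (hwbc : ∀ x ∈ bCyl R, ∀ i, w x i = ncomp R x (w x) * (nuR R x i : ℂ)) (θ t : ℝ) :
    let x : V3 := ![R * Real.cos θ, R * Real.sin θ, t]
    ∑ j, flux (Phi1 ε u) (Psi1 ε μ w) j x * (nuR R x j : ℂ)
      = -hinner (SPhi1 R ε u x) (Psi1 ε μ w x) := by
  intro x
  have hx : x ∈ closedCyl R := bCyl_subset_closedCyl R (polar_mem_bCyl R θ t)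
  have key := normal_deriv_of_normal hR (e := fun y => (ε y : ℂ)) (u := u)
    (fun y hy => ((hε y hy).of_le (by norm_num)).ofReal_comp)
    (fun i y hy => (hu i y hy).of_le (by norm_num)) hdiv hubc θ t
  obtain ⟨w0, w1, w2⟩ : _ ∧ _ ∧ _ := normal_components hR (θ := θ) (t := t) hwbc
  have hν : nuR R x = ![Real.cos θ, Real.sin θ, 0] := nuR_polar hR θ t
  have h0 : (ε x : ℂ) ≠ 0 := by exact_mod_cast (hεpos x hx).ne'
  have hR0 : (R : ℂ) ≠ 0 := by exact_mod_cast hR.ne'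
  change w x 0 = (w x 0 * Real.cos θ + w x 1 * Real.sin θ) * Real.cos θ at w0
  change w x 1 = (w x 0 * Real.cos θ + w x 1 * Real.sin θ) * Real.sin θ at w1
  change w x 2 = 0 at w2
  generalize hb : w x 0 * Real.cos θ + w x 1 * Real.sin θ = b at w0 w1
  change R * (ε x : ℂ) * _ + (ε x : ℂ) * _ + R * (∑ j, pd j (fun y => (ε y : ℂ)) x * _) * _ = 0
    at key
  simp only [pd_ofReal _ ((hε x hx).differentiableAt (by norm_num))] at key
  change R * (ε x : ℂ) * (∑ i, (∑ j, pd j (fun y => u y i) x * _) * _)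
    + (ε x : ℂ) * (∑ i, u x i * _) + R * _ * (∑ i, u x i * _) = 0 at key
  simp only [Fin.sum_univ_three, Matrix.cons_val] at key
  have hconj (i) : (starRingEnd ℂ) (Psi1 ε μ w x i)
      = ((Real.sqrt (ε x))⁻¹ * (μ x)⁻¹ : ℝ) * (starRingEnd ℂ) (w x i) := by
    simp [Psi1]
  have hP (i) : Phi1 ε u x i = Real.sqrt (ε x) * u x i := rfl
  simp only [flux, hinner, pdV, pd_Phi1 (hε x hx) (hεpos x hx) (fun i => hu i x hx), hconj]
  simp only [SPhi1, hP, dnu, hν, Fin.sum_univ_three, w0, w1, w2, Matrix.cons_val,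
    map_mul, map_zero, Complex.conj_ofReal]
  generalize (((Real.sqrt (ε x))⁻¹ * (μ x)⁻¹ : ℝ) : ℂ) = q
  push_cast at key ⊢
  linear_combination (norm := (field_simp; ring))
    (Real.sqrt (ε x) * q * (starRingEnd ℂ) b * (R : ℂ)⁻¹ * (ε x : ℂ)⁻¹) * key

/-- The boundary flux of a field which is tangential on the boundary. -/
lemma flux_tangential {R : ℝ} (hR : 0 < R) {k : V3 → ℂ} {u v f : V3 → C3}
    (hμ : ∀ x ∈ closedCyl R, ContDiffAt ℝ 2 μ x) (hμpos : ∀ x ∈ closedCyl R, 0 < μ x)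
    (hk : ∀ x ∈ closedCyl R, ContinuousAt k x)
    (hu : ∀ i, ∀ x ∈ closedCyl R, ContinuousAt (fun y => u y i) x)
    (hv : ∀ i, ∀ x ∈ closedCyl R, ContDiffAt ℝ 2 (fun y => v y i) x)
    (hcurl : ∀ x ∈ Cyl R, vcurl v x = k x • u x)
    (hubc : ∀ x ∈ bCyl R, ∀ i, u x i = ncomp R x (u x) * (nuR R x i : ℂ))
    (hvbc : ∀ x ∈ bCyl R, ncomp R x (v x) = 0)
    (hfbc : ∀ x ∈ bCyl R, ncomp R x (f x) = 0) (θ t : ℝ) :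
    let x : V3 := ![R * Real.cos θ, R * Real.sin θ, t]
    ∑ j, flux (Phi2 μ v) (Psi2 ε μ f) j x * (nuR R x j : ℂ)
      = -hinner (SPhi2 R μ v x) (Psi2 ε μ f x) := by
  intro x
  have hx : x ∈ closedCyl R := bCyl_subset_closedCyl R (polar_mem_bCyl R θ t)
  obtain ⟨k1, k2⟩ : _ ∧ _ := normal_deriv_of_tangential hR hk hu
    (fun i y hy => (hv i y hy).of_le (by norm_num)) hcurl hubc hvbc θ t
  have hf : f x 0 * Real.cos θ + f x 1 * Real.sin θ = 0 :=
    tangential_components hR (θ := θ) (t := t) hfbc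
  have hcs := ofReal_cos_sq_add_sin_sq θ
  have hν : nuR R x = ![Real.cos θ, Real.sin θ, 0] := nuR_polar hR θ t
  have h0 : (μ x : ℂ) ≠ 0 := by exact_mod_cast (hμpos x hx).ne'
  have hR0 : (R : ℂ) ≠ 0 := by exact_mod_cast hR.ne'
  obtain ⟨b, f0, f1⟩ : ∃ b, f x 0 = -(b * Real.sin θ) ∧ f x 1 = b * Real.cos θ :=
    ⟨Real.cos θ * f x 1 - Real.sin θ * f x 0,
      by linear_combination Real.cos θ * hf - f x 0 * hcs,
      by linear_combination Real.sin θ * hf - f x 1 * hcs⟩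
  change R * (Real.cos θ * (∑ j, pd j (fun y => v y 1) x * _)
    - Real.sin θ * (∑ j, pd j (fun y => v y 0) x * _))
      + (Real.cos θ * v x 1 - Real.sin θ * v x 0) = 0 at k1
  change ∑ j, pd j (fun y => v y 2) x * _ = 0 at k2
  simp only [Fin.sum_univ_three, Matrix.cons_val] at k1 k2
  have hconj (i) : (starRingEnd ℂ) (Psi2 ε μ f x i)
      = ((ε x)⁻¹ * (Real.sqrt (μ x))⁻¹ : ℝ) * (starRingEnd ℂ) (f x i) := by
    simp [Psi2]
  have hP (i) : Phi2 μ v x i = Real.sqrt (μ x) * v x i := rfl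
  have hd (i j) : pd j (fun y => Phi2 μ v y i) x = Real.sqrt (μ x)
      * ((2 * μ x : ℂ)⁻¹ * pdR j μ x * v x i + pd j (fun y => v y i) x) :=
    pd_Phi1 (hμ x hx) (hμpos x hx) (fun i => hv i x hx) i j
  have h02 : (0 : Fin 3) ≠ 2 := by decide
  have h12 : (1 : Fin 3) ≠ 2 := by decide
  simp only [flux, hinner, pdV, hd, hconj, SPhi2, hP, dnu, hν, Fin.sum_univ_three, f0, f1,
    Matrix.cons_val, map_mul, map_neg, Complex.conj_ofReal, if_neg h02, if_neg h12, if_true]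
  generalize (((ε x)⁻¹ * (Real.sqrt (μ x))⁻¹ : ℝ) : ℂ) = q
  push_cast at k1 k2 ⊢
  linear_combination (norm := (field_simp; ring))
    (Real.sqrt (μ x) * q * (starRingEnd ℂ) b * (R : ℂ)⁻¹) * k1
      + Real.sqrt (μ x) * q * (starRingEnd ℂ) (f x 2) * k2

end Flux

/-- the eigenfunction pair of the Maxwell operator yields a solution of the
integral identity for the matrix Schrödinger operator −Δ + V with boundary potential Σ:
∫_Π (Σⱼ⟨∂ⱼΦ, ∂ⱼΨ⟩_{ℂ⁶} + ⟨VΦ, Ψ⟩_{ℂ⁶}) dx + ∫_{∂Π} ⟨ΣΦ, Ψ⟩_{ℂ⁶} dS = 0,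
the ℂ⁶ inner products being written out in 3×3 blocks. -/
theorem statement15 (R : ℝ) (hR : 0 < R) (ε μ : V3 → ℝ) (lam : ℝ) (u v : V3 → C3)
    (hε : UpTo 2 (Cyl R) ε) (hμ : UpTo 2 (Cyl R) μ)
    (hεpos : ∀ x ∈ closure (Cyl R), 0 < ε x) (hμpos : ∀ x ∈ closure (Cyl R), 0 < μ x)
    (hu : UpTo 2 (Cyl R) u) (hv : UpTo 2 (Cyl R) v)
    (hus : AxialSupp u) (hvs : AxialSupp v)
    (hequ : ∀ x ∈ Cyl R, vcurl u x = (Complex.I * (lam : ℂ) * (μ x : ℂ)) • v x)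
    (heqv : ∀ x ∈ Cyl R, vcurl v x = (-(Complex.I * (lam : ℂ) * (ε x : ℂ))) • u x)
    (hdivu : ∀ x ∈ Cyl R, vdiv (fun y => (ε y : ℂ) • u y) x = 0)
    (hdivv : ∀ x ∈ Cyl R, vdiv (fun y => (μ y : ℂ) • v y) x = 0)
    (hubc : ∀ x ∈ bCyl R, ∀ i, u x i = ncomp R x (u x) * (nuR R x i : ℂ))
    (hvbc : ∀ x ∈ bCyl R, ncomp R x (v x) = 0)
    (w f : V3 → C3) (hw : UpTo 2 (Cyl R) w) (hf : UpTo 2 (Cyl R) f)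
    (hwbc : ∀ x ∈ bCyl R, ∀ i, w x i = ncomp R x (w x) * (nuR R x i : ℂ))
    (hfbc : ∀ x ∈ bCyl R, ncomp R x (f x) = 0) :
    (∫ x in Cyl R,
        (∑ j, (hinner (pdV j (Phi1 ε u) x) (pdV j (Psi1 ε μ w) x)
            + hinner (pdV j (Phi2 μ v) x) (pdV j (Psi2 ε μ f) x)))
        + hinner (VPhi1 ε μ lam u v x) (Psi1 ε μ w x)
        + hinner (VPhi2 ε μ lam u v x) (Psi2 ε μ f x))
      + surfInt R (fun x =>
          hinner (SPhi1 R ε u x) (Psi1 ε μ w x)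
          + hinner (SPhi2 R μ v x) (Psi2 ε μ f x)) = 0 := by
  have hε' (x) (hx : x ∈ closedCyl R) : ContDiffAt ℝ 2 ε x := hε.contDiffAt hR hx
  have hμ' (x) (hx : x ∈ closedCyl R) : ContDiffAt ℝ 2 μ x := hμ.contDiffAt hR hx
  have hεp (x) (hx : x ∈ closedCyl R) : 0 < ε x := hεpos x (closedCyl_subset_closure hR hx)
  have hμp (x) (hx : x ∈ closedCyl R) : 0 < μ x := hμpos x (closedCyl_subset_closure hR hx)
  have hu' (i) (x) (hx : x ∈ closedCyl R) : ContDiffAt ℝ 2 (fun y => u y i) x :=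
    hu.contDiffAt_apply hR hx i
  have hv' (i) (x) (hx : x ∈ closedCyl R) : ContDiffAt ℝ 2 (fun y => v y i) x :=
    hv.contDiffAt_apply hR hx i
  have hΦ1 (x) (hx : x ∈ closedCyl R) (i) : ContDiffAt ℝ 2 (fun y => Phi1 ε u y i) x :=
    contDiffAt_Phi1 (hε' x hx) (hεp x hx) (fun i => hu' i x hx) i
  have hΦ2 (x) (hx : x ∈ closedCyl R) (i) : ContDiffAt ℝ 2 (fun y => Phi2 μ v y i) x :=
    contDiffAt_Phi1 (hμ' x hx) (hμp x hx) (fun i => hv' i x hx) i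
  have hΨ1 (x) (hx : x ∈ closedCyl R) (i) : ContDiffAt ℝ 2 (fun y => Psi1 ε μ w y i) x :=
    contDiffAt_Psi1 (hε' x hx) (hεp x hx) (hμ' x hx) (hμp x hx) (hw.contDiffAt_apply hR hx) i
  have hΨ2 (x) (hx : x ∈ closedCyl R) (i) : ContDiffAt ℝ 2 (fun y => Psi2 ε μ f y i) x :=
    contDiffAt_Psi2 (hε' x hx) (hεp x hx) (hμ' x hx) (hμp x hx) (hf.contDiffAt_apply hR hx) i
  have hG1 (j) (x) (hx : x ∈ closedCyl R) := contDiffAt_flux (hΦ1 x hx) (hΨ1 x hx) j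
  have hG2 (j) (x) (hx : x ∈ closedCyl R) := contDiffAt_flux (hΦ2 x hx) (hΨ2 x hx) j
  have hdivergence := integral_divergence_Cyl hR
    (G := fun j x => flux (Phi1 ε u) (Psi1 ε μ w) j x + flux (Phi2 μ v) (Psi2 ε μ f) j x)
    (fun j x hx => (hG1 j x hx).add (hG2 j x hx))
    (fun j => (axialSupp_flux (fun i => hus.smul_apply i) j).add
      (axialSupp_flux (fun i => hvs.smul_apply i) j))
  have hvolume : ∀ x ∈ Cyl R,
      (∑ j, (hinner (pdV j (Phi1 ε u) x) (pdV j (Psi1 ε μ w) x)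
            + hinner (pdV j (Phi2 μ v) x) (pdV j (Psi2 ε μ f) x)))
        + hinner (VPhi1 ε μ lam u v x) (Psi1 ε μ w x)
        + hinner (VPhi2 ε μ lam u v x) (Psi2 ε μ f x)
      = ∑ j, pd j (fun x => flux (Phi1 ε u) (Psi1 ε μ w) j x
          + flux (Phi2 μ v) (Psi2 ε μ f) j x) x := by
    intro x hx
    have hx' := Cyl_subset_closedCyl R hx
    have hnhds := (isOpen_Cyl R).mem_nhds hx
    have hL1 : (fun i => ∑ j, pd j (pd j (fun y => Phi1 ε u y i)) x) = VPhi1 ε μ lam u v x :=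
      funext (laplacian_Phi1 (hε' x hx') (hμ' x hx') (hεp x hx') (hμp x hx') (fun i => hu' i x hx')
        (fun i => hv' i x hx') (Filter.mem_of_superset hnhds hequ) (heqv x hx)
        (Filter.mem_of_superset hnhds hdivu))
    have hL2 : (fun i => ∑ j, pd j (pd j (fun y => Phi2 μ v y i)) x) = VPhi2 ε μ lam u v x :=
      funext (laplacian_Phi2 (hε' x hx') (hμ' x hx') (hεp x hx') (hμp x hx') (fun i => hu' i x hx')
        (fun i => hv' i x hx') (hequ x hx) (Filter.mem_of_superset hnhds heqv)
        (Filter.mem_of_superset hnhds hdivv))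
    have hG (j) := pd_add j ((hG1 j x hx').differentiableAt (by norm_num))
      ((hG2 j x hx').differentiableAt (by norm_num))
    rw [Finset.sum_congr rfl fun j _ => hG j, Finset.sum_add_distrib, Finset.sum_add_distrib,
      sum_pd_flux (hΦ1 x hx') (hΨ1 x hx'), sum_pd_flux (hΦ2 x hx') (hΨ2 x hx'), hL1, hL2]
    ring
  have hsurface : surfInt R (fun x => ∑ j, (flux (Phi1 ε u) (Psi1 ε μ w) j x
        + flux (Phi2 μ v) (Psi2 ε μ f) j x) * (nuR R x j : ℂ))
      = surfInt R (fun x => -(hinner (SPhi1 R ε u x) (Psi1 ε μ w x)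
          + hinner (SPhi2 R μ v x) (Psi2 ε μ f x))) := by
    simp only [surfInt, add_mul, Finset.sum_add_distrib, neg_add,
      flux_normal hR hε' hεp hu' hdivu hubc hwbc,
      flux_tangential hR hμ' hμp (k := fun x => -(Complex.I * (lam : ℂ) * (ε x : ℂ)))
        (fun x hx => (continuousAt_const.mul (hε' x hx).ofReal_comp.continuousAt).neg)
        (fun i x hx => (hu' i x hx).continuousAt) hv' heqv hubc hvbc hfbc]
  rw [setIntegral_congr_fun (isOpen_Cyl R).measurableSet hvolume, hdivergence, hsurface,
    surfInt_neg, neg_add_cancel]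

end
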